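/- arXiv:1610.01920 — 2 statements merged into one kernel-verified Lean document; each statement's English description precedes it below -/
import Mathlib

section
/- For Algorithm 5 and every k ≥ 0, the maximum of MSB(y) over y ∈ Y⁽ᵏ⁾ equals k + 2. -/
/-- The sets `Y⁽ᵏ⁾` of Algorithm 5: `Y⁽⁰⁾ = {0, 1, 2}`, and
`Y⁽ᵏ⁺¹⁾ = Y⁽ᵏ⁾ ∪ {2^(k+2) ⊕ y : y ∈ Y⁽ᵏ⁾, MSB(y) = k+1}
            ∪ {2^(k+2) ⊕ 2^k ⊕ y : y ∈ Y⁽ᵏ⁾, MSB(y) = k+1}`. -/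
def Y5 : ℕ → Finset ℕ
  | 0 => {0, 1, 2}
  | k + 1 =>
      Y5 k ∪
        (((Y5 k).filter (fun y => Nat.size y = k + 1)).image
            (fun y => 2 ^ (k + 2) ^^^ y) ∪
          ((Y5 k).filter (fun y => Nat.size y = k + 1)).image
            (fun y => 2 ^ (k + 2) ^^^ 2 ^ k ^^^ y))

theorem Nat.size_two_pow_xor {n y : ℕ} (hy : y < 2 ^ n) : Nat.size (2 ^ n ^^^ y) = n + 1 := by
  apply le_antisymm
  · exact Nat.size_le.2 (Nat.xor_lt_two_pow (Nat.pow_lt_pow_right one_lt_two n.lt_succ_self)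
      (hy.trans (Nat.pow_lt_pow_right one_lt_two n.lt_succ_self)))
  · refine Nat.lt_size.2 (Nat.ge_two_pow_of_testBit ?_)
    simp [Nat.testBit_xor, Nat.testBit_lt_two_pow hy]

theorem size_le_of_mem_Y5 {k y : ℕ} (hy : y ∈ Y5 k) : Nat.size y ≤ k + 2 := by
  induction k generalizing y with
  | zero =>
    simp only [Y5, Finset.mem_insert, Finset.mem_singleton] at hy
    exact Nat.size_le.2 (by omega)
  | succ k ih =>
    simp only [Y5, Finset.mem_union, Finset.mem_image, Finset.mem_filter] at hy
    rcases hy with hy | ⟨z, ⟨-, hz⟩, rfl⟩ | ⟨z, ⟨-, hz⟩, rfl⟩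
    · exact (ih hy).trans (by omega)
    · have hz' : z < 2 ^ (k + 2) := Nat.size_le.1 (by omega)
      exact (Nat.size_two_pow_xor hz').le
    · have hz' : z < 2 ^ (k + 2) := Nat.size_le.1 (by omega)
      rw [Nat.xor_assoc]
      exact (Nat.size_two_pow_xor (Nat.xor_lt_two_pow
        (Nat.pow_lt_pow_right one_lt_two (by omega)) hz')).le

theorem exists_mem_Y5_size_eq (k : ℕ) :
    (∃ y ∈ Y5 k, Nat.size y = k + 1) ∧ ∃ y ∈ Y5 k, Nat.size y = k + 2 := by
  induction k with
  | zero =>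
    exact ⟨⟨1, by simp [Y5], Nat.size_one⟩, 2, by simp [Y5], Nat.size_pow (n := 1)⟩
  | succ k ih =>
    obtain ⟨⟨y, hy, hsy⟩, z, hz, hsz⟩ := ih
    refine ⟨⟨z, by simp [Y5, hz], hsz⟩, 2 ^ (k + 2) ^^^ y, ?_,
      Nat.size_two_pow_xor (Nat.size_le.1 (by omega))⟩
    simp only [Y5, Finset.mem_union, Finset.mem_image, Finset.mem_filter]
    exact Or.inr (Or.inl ⟨y, ⟨hy, hsy⟩, rfl⟩)

/-- For Algorithm 5 and every `k ≥ 0`, the maximum of `MSB(y)` over `y ∈ Y⁽ᵏ⁾`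
equals `k + 2`. -/
theorem stmt_8 (k : ℕ) : (Y5 k).sup Nat.size = k + 2 := by
  refine le_antisymm (Finset.sup_le fun _ => size_le_of_mem_Y5) ?_
  obtain ⟨-, y, hy, hs⟩ := exists_mem_Y5_size_eq k
  exact hs ▸ Finset.le_sup hy
end

section
/- For Algorithm 5, the cardinalities satisfy |Z⁽ᵏ⁺²⁾| = 2·|Z⁽ᵏ⁾| for every k ≥ 1, with initial values |Z⁽¹⁾| = 2 and |Z⁽²⁾| = 2. -/
/-- The sets `Z⁽ᵏ⁾` of Algorithm 5 (for `k ≥ 1`). -/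
def Z5 (k : ℕ) : Finset ℕ :=
  ((Y5 (k - 1)).filter (fun y => Nat.size y = k)).image
      (fun y => 2 ^ (k + 1) ^^^ y) ∪
    ((Y5 (k - 1)).filter (fun y => Nat.size y = k)).image
      (fun y => 2 ^ (k + 1) ^^^ 2 ^ (k - 1) ^^^ y)

theorem Y5_succ (k : ℕ) : Y5 (k + 1) = Y5 k ∪ Z5 (k + 1) := rfl

theorem Nat.testBit_of_size_eq_succ {n y : ℕ} (h : Nat.size y = n + 1) :
    y.testBit n = true := by
  have hlt : y < 2 ^ (n + 1) := Nat.size_le.1 h.le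
  have hle : 2 ^ n ≤ y := Nat.lt_size.1 (by omega)
  obtain ⟨i, hi, hbit⟩ := Nat.exists_ge_and_testBit_of_ge_two_pow hle
  have hin : i < n + 1 := by
    by_contra! hcon
    rw [Nat.testBit_lt_two_pow (hlt.trans_le (Nat.pow_le_pow_right two_pos hcon))] at hbit
    simp at hbit
  obtain rfl : i = n := by omega
  exact hbit

theorem Nat.size_two_pow_xor_of_lt {n w : ℕ} (h : w < 2 ^ n) :
    Nat.size (2 ^ n ^^^ w) = n + 1 := by
  apply le_antisymm
  · rw [Nat.size_le]
    have hpow : 2 ^ n < 2 ^ (n + 1) := Nat.pow_lt_pow_right one_lt_two n.lt_succ_self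
    exact Nat.xor_lt_two_pow hpow (h.trans hpow)
  · rw [Nat.succ_le_iff, Nat.lt_size]
    apply Nat.ge_two_pow_of_testBit
    simp [Nat.testBit_xor, Nat.testBit_lt_two_pow h]

theorem size_of_mem_Z5 {k z : ℕ} (hz : z ∈ Z5 (k + 1)) : Nat.size z = k + 3 := by
  simp only [Z5, Finset.mem_union, Finset.mem_image, Finset.mem_filter,
    Nat.add_sub_cancel] at hz
  have hpow : 2 ^ (k + 1) < 2 ^ (k + 2) := Nat.pow_lt_pow_right one_lt_two (by omega)
  rcases hz with ⟨y, ⟨-, hy⟩, rfl⟩ | ⟨y, ⟨-, hy⟩, rfl⟩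
  · exact Nat.size_two_pow_xor_of_lt ((Nat.size_le.1 hy.le).trans hpow)
  · rw [Nat.xor_assoc]
    refine Nat.size_two_pow_xor_of_lt (Nat.xor_lt_two_pow ?_ ((Nat.size_le.1 hy.le).trans hpow))
    exact Nat.pow_lt_pow_right one_lt_two (by omega)

theorem filter_size_Y5 (k : ℕ) :
    (Y5 (k + 2)).filter (fun y => Nat.size y = k + 3) = Z5 (k + 1) := by
  ext y
  rw [Finset.mem_filter, Y5_succ, Y5_succ, Finset.mem_union, Finset.mem_union]
  constructor
  · rintro ⟨(hy | hy) | hy, hs⟩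
    · have := size_le_of_mem_Y5 hy
      omega
    · exact hy
    · have := size_of_mem_Z5 hy
      omega
  · exact fun hy => ⟨.inl (.inr hy), size_of_mem_Z5 hy⟩

theorem card_Z5_succ (k : ℕ) :
    (Z5 (k + 1)).card = 2 * ((Y5 k).filter (fun y => Nat.size y = k + 1)).card := by
  rw [Z5, Nat.add_sub_cancel, Finset.card_union_of_disjoint,
    Finset.card_image_of_injective _ fun _ _ h => Nat.xor_right_injective h,
    Finset.card_image_of_injective _ fun _ _ h => Nat.xor_right_injective h, two_mul]
  rw [Finset.disjoint_left]
  intro z hz hz'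
  simp only [Finset.mem_image, Finset.mem_filter] at hz hz'
  obtain ⟨y, ⟨-, hy⟩, rfl⟩ := hz
  obtain ⟨y', ⟨-, hy'⟩, h⟩ := hz'
  rw [Nat.xor_assoc] at h
  have hbit := congrArg (Nat.testBit · k) (Nat.xor_right_injective h)
  simp [Nat.testBit_xor, Nat.testBit_of_size_eq_succ hy, Nat.testBit_of_size_eq_succ hy'] at hbit

/-- For Algorithm 5, `|Z⁽ᵏ⁺²⁾| = 2·|Z⁽ᵏ⁾|` for every `k ≥ 1`, with initial
values `|Z⁽¹⁾| = 2` and `|Z⁽²⁾| = 2`. -/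
theorem stmt_12 :
    (Z5 1).card = 2 ∧ (Z5 2).card = 2 ∧
      ∀ k, 1 ≤ k → (Z5 (k + 2)).card = 2 * (Z5 k).card := by
  refine ⟨by decide, by decide, fun k hk => ?_⟩
  obtain ⟨m, rfl⟩ := Nat.exists_eq_add_of_le' hk
  rw [card_Z5_succ, filter_size_Y5]
end
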